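/- arXiv:2112.15221 — 3 statements merged into one kernel-verified Lean document; each statement's English description precedes it below -/
import Mathlib

section
/- Consider a UCB arm-selection process over K ≥ 1 arms with exponent η > 0 and confidence function z : ℕ → ℝ that is nondecreasing and tends to infinity. Then every arm that is never eliminated is selected infinitely often; equivalently, for every k ∈ ⋂_h 𝒜(h), T_k(h) → ∞ as h → ∞. -/
open Filter Topology

/-- The number of times arm `k` has been selected before episode `h`:
`T_k(h) = #{i < h : σ i = k}`. -/
def armCount {K : ℕ} (σ : ℕ → Fin K) (k : Fin K) (h : ℕ) : ℕ :=
  ((Finset.range h).filter (fun i => σ i = k)).card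

theorem armCount_mono {K : ℕ} (σ : ℕ → Fin K) (k : Fin K) : Monotone (armCount σ k) := by
  intro a b hab
  unfold armCount
  apply Finset.card_le_card
  apply Finset.filter_subset_filter
  exact Finset.range_mono hab

theorem armCount_succ_of_eq {K : ℕ} (σ : ℕ → Fin K) (k : Fin K) (h : ℕ) (hk : σ h = k) :
    armCount σ k (h + 1) = armCount σ k h + 1 := by
  unfold armCount
  rw [Finset.range_add_one, Finset.filter_insert, if_pos hk, Finset.card_insert_of_notMem]
  simp

theorem armCount_tendsto {K : ℕ} (σ : ℕ → Fin K) (j : Fin K) (hj : ∃ᶠ h in atTop, σ h = j) :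
    Tendsto (armCount σ j) atTop atTop := by
  apply tendsto_atTop_atTop_of_monotone (armCount_mono σ j)
  intro b
  induction b with
  | zero => exact ⟨0, Nat.zero_le _⟩
  | succ b ih =>
    obtain ⟨a, ha⟩ := ih
    obtain ⟨h, hah, hh⟩ := (frequently_atTop.1 hj) a
    refine ⟨h + 1, ?_⟩
    rw [armCount_succ_of_eq σ j h hh]
    have := armCount_mono σ j hah
    omega

/-- In a UCB arm-selection process over `K ≥ 1` arms with exponent
`η > 0` and a nondecreasing confidence function `z` tending to infinity, every arm
that is never eliminated is selected infinitely often: for every `k ∈ ⋂_h 𝒜(h)`,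
`T_k(h) → ∞` as `h → ∞`. -/
theorem csrl_unremoved_arm_selected_infinitely_often
    (K : ℕ) (hK : 1 ≤ K)
    (σ : ℕ → Fin K)
    (Jbar : Fin K → ℕ → ℝ)
    (Jmax : ℝ) (hJmaxpos : 0 < Jmax)
    (hJbdd : ∀ k n, |Jbar k n| ≤ Jmax)
    (z : ℕ → ℝ) (η : ℝ) (hη0 : 0 < η)
    (hzmono : Monotone z)
    (hztop : Tendsto z atTop atTop)
    (𝒜 : ℕ → Finset (Fin K))
    (h𝒜mono : ∀ h, 𝒜 (h + 1) ⊆ 𝒜 h)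
    (hσ𝒜 : ∀ h, σ h ∈ 𝒜 h)
    (h₀ : ℕ)
    (hinit : ∀ k ∈ 𝒜 h₀, 1 ≤ armCount σ k h₀)
    (hUCB : ∀ h ≥ h₀, ∀ k ∈ 𝒜 h,
      Jbar k (armCount σ k h) + z h / (armCount σ k h : ℝ) ^ η ≤
        Jbar (σ h) (armCount σ (σ h) h) + z h / (armCount σ (σ h) h : ℝ) ^ η) :
    ∀ k, (∀ h, k ∈ 𝒜 h) → Tendsto (fun h => armCount σ k h) atTop atTop := by
  intro k hk
  by_contra hcon
  have hbd : ∃ N, ∀ h, armCount σ k h < N := by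
    by_contra! hN
    exact hcon (tendsto_atTop_atTop_of_monotone (armCount_mono σ k) hN)
  obtain ⟨N, hN⟩ := hbd
  have hj : ∃ j, ∃ᶠ h in atTop, σ h = j := by
    by_contra! hno
    have h1 : ∀ j, ∀ᶠ h in atTop, σ h ≠ j := hno
    obtain ⟨h, hh⟩ := (eventually_all.2 h1).exists
    exact hh (σ h) rfl
  obtain ⟨j, hj⟩ := hj
  have hNpos : (0 : ℝ) < N := by
    have := hN 0
    exact_mod_cast (by omega : 0 < N)
  have hP : (0 : ℝ) < (N : ℝ) ^ η := Real.rpow_pos_of_pos hNpos η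
  have hT : Tendsto (fun h => ((armCount σ j h : ℕ) : ℝ) ^ η) atTop atTop :=
    (tendsto_rpow_atTop hη0).comp (tendsto_natCast_atTop_atTop.comp (armCount_tendsto σ j hj))
  obtain ⟨h, hsel, hge, hTj, hz⟩ := (hj.and_eventually ((eventually_ge_atTop h₀).and
    ((hT.eventually_ge_atTop (2 * (N : ℝ) ^ η)).and
      (hztop.eventually_ge_atTop (4 * Jmax * (N : ℝ) ^ η + (N : ℝ) ^ η))))).exists
  have hu := hUCB h hge k (hk h)
  rw [hsel] at hu
  have hk1 : 1 ≤ armCount σ k h := (hinit k (hk h₀)).trans (armCount_mono σ k hge)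
  have hk1R : (0 : ℝ) < armCount σ k h := by exact_mod_cast hk1
  have hkN : (armCount σ k h : ℝ) ≤ N := by exact_mod_cast (hN h).le
  have hzpos : 0 < z h := lt_of_lt_of_le (by positivity) hz
  have e1 : z h / (N : ℝ) ^ η ≤ z h / (armCount σ k h : ℝ) ^ η :=
    div_le_div_of_nonneg_left hzpos.le (Real.rpow_pos_of_pos hk1R η)
      (Real.rpow_le_rpow hk1R.le hkN hη0.le)
  have e2 : z h / (armCount σ j h : ℝ) ^ η ≤ z h / (2 * (N : ℝ) ^ η) :=
    div_le_div_of_nonneg_left hzpos.le (by positivity) hTj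
  have e3 : z h / (2 * (N : ℝ) ^ η) = (z h / (N : ℝ) ^ η) / 2 := by
    field_simp
  have e4 : 4 * Jmax + 1 ≤ z h / (N : ℝ) ^ η := by
    rw [le_div_iff₀ hP]
    linarith
  have b1 := abs_le.1 (hJbdd k (armCount σ k h))
  have b2 := abs_le.1 (hJbdd j (armCount σ j h))
  linarith [b1.1, b2.2]
end

section
/- For an elimination process over a finite family of constraints, if a policy π : S → A satisfies some constraint C_i of the family, then at every time n some active constraint is satisfied by π: there exists j ∈ 𝒜(n) with π(s) ∈ C_j(s) for every state s. -/
/-- Constraint `C i` is a subset of (more restricted than) `C j`: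
`C_i(s) ⊆ C_j(s)` for every state `s`. -/
def IsSubConstraint {S A ι : Type*} (C : ι → S → Set A) (i j : ι) : Prop :=
  ∀ s, C i s ⊆ C j s

/-- An elimination process over the family of constraints `C`: the active sets start
at everything, and at each step either nothing changes or a single active constraint
`i` is removed, provided a distinct active constraint `j` remains with `C i` a subset
of `C j` and `C i ≠ C j`. -/
def IsEliminationProcess {S A ι : Type*} [Fintype ι] [DecidableEq ι]
    (C : ι → S → Set A) (𝒜 : ℕ → Finset ι) : Prop :=
  𝒜 0 = Finset.univ ∧
    ∀ n, 𝒜 (n + 1) = 𝒜 n ∨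
      ∃ i ∈ 𝒜 n, (∃ j ∈ 𝒜 n, j ≠ i ∧ IsSubConstraint C i j ∧ C i ≠ C j) ∧
        𝒜 (n + 1) = 𝒜 n \ {i}

/-- For an elimination process over a finite family of constraints, if a
policy `π` satisfies some constraint `C i` of the family, then at every time `n` some
active constraint is satisfied by `π`: there exists `j ∈ 𝒜 n` with `π s ∈ C j s` for
every state `s`. -/
theorem elimination_preserves_satisfying_constraint
    {S A ι : Type*} [Fintype ι] [DecidableEq ι]
    (C : ι → S → Set A) (𝒜 : ℕ → Finset ι)
    (hproc : IsEliminationProcess C 𝒜)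
    (π : S → A) (i : ι) (hπ : ∀ s, π s ∈ C i s) :
    ∀ n, ∃ j ∈ 𝒜 n, ∀ s, π s ∈ C j s := by
  intro n
  induction n with
  | zero => exact ⟨i, by rw [hproc.1]; exact Finset.mem_univ i, hπ⟩
  | succ n ih =>
    obtain ⟨j, hj, hjs⟩ := ih
    rcases hproc.2 n with h | ⟨k, hk, ⟨l, hl, hlk, hsub, -⟩, h⟩
    · exact ⟨j, by rw [h]; exact hj, hjs⟩
    · rw [h]
      by_cases hjk : j = k
      · subst hjk
        exact ⟨l, by simp [hl, hlk], fun s => hsub s (hjs s)⟩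
      · exact ⟨j, by simp [hj, hjk], hjs⟩
end

section
/- Let I be a finite nonempty index set, let η > 0, c' > 0, J_max > 0 and a be real constants, let z : ℕ → ℝ be nondecreasing with z(h) → ∞, let N be a natural number, and for each j ∈ I let T_j : ℕ → ℕ satisfy T_j(h) → ∞ as h → ∞ and let g_j : ℕ → ℝ satisfy |g_j(n)| ≤ J_max for all n. Then it is NOT the case that for every h > N there exists j ∈ I with a + c'·z(h) ≤ g_j(T_j(h)) + z(h)/T_j(h)^η. -/
open Filter Topology

/-- Let `I` be a finite nonempty index set, `η > 0`, `c' > 0`,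
`J_max > 0`, `a` a real constant, `z` nondecreasing with `z h → ∞`, `N : ℕ`, and for
each `j ∈ I` let `T j h → ∞` and `|g j n| ≤ J_max`.  Then it is not the case that for
every `h > N` there exists `j ∈ I` with
`a + c' * z h ≤ g j (T j h) + z h / (T j h)^η`. -/
theorem frozen_arm_not_perpetually_dominated
    (I : Type*) [Fintype I] [Nonempty I]
    (η c' Jmax a : ℝ) (hη : 0 < η) (hc' : 0 < c') (hJmax : 0 < Jmax)
    (z : ℕ → ℝ) (hzmono : Monotone z) (hztop : Tendsto z atTop atTop)
    (N : ℕ)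
    (T : I → ℕ → ℕ) (hT : ∀ j, Tendsto (T j) atTop atTop)
    (g : I → ℕ → ℝ) (hg : ∀ j n, |g j n| ≤ Jmax) :
    ¬ ∀ h, N < h → ∃ j : I, a + c' * z h ≤ g j (T j h) + z h / (T j h : ℝ) ^ η := by
  intro H
  have h1 : ∀ᶠ h in atTop, ∀ j, 2 / c' ≤ (T j h : ℝ) ^ η := by
    rw [eventually_all]
    intro j
    exact ((tendsto_rpow_atTop hη).comp
      (tendsto_natCast_atTop_atTop.comp (hT j))).eventually_ge_atTop (2 / c')
  obtain ⟨h, hw, hN, hz, hz0⟩ := (h1.and ((eventually_gt_atTop N).and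
    ((hztop.eventually_gt_atTop (2 * (Jmax - a) / c')).and
      (hztop.eventually_gt_atTop 0)))).exists
  obtain ⟨j, hj⟩ := H h hN
  have hwj := hw j
  have hgj := (abs_le.mp (hg j (T j h))).2
  have hpos : 0 < (T j h : ℝ) ^ η := lt_of_lt_of_le (by positivity) hwj
  have hb : z h / (T j h : ℝ) ^ η ≤ z h * (c' / 2) := by
    rw [div_le_iff₀ hpos]
    rw [div_le_iff₀ hc'] at hwj
    nlinarith
  rw [div_lt_iff₀ hc'] at hz
  nlinarith
end
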